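/- Fix an integer constant r ≥ 2 and constants p₀ > 0, p₁ > 0, δ ∈ (0,1]. There exist constants c > 0, C > 0, γ₀ ∈ (0,1) and n₀ ∈ ℕ such that for all n ≥ n₀ the following holds: for the non-elitist EA maximizing Plateau_r on {0,1}^n, using an unbiased mutation operator whose number ξ of flipped bits satisfies Pr(ξ = 0) ≥ p₀ and Pr(ξ = 1) ≥ p₁, using either k-tournament selection with k ≥ (1+δ)/p₀ or (μ,λ)-selection with λ/μ ≥ (1+δ)/p₀, and population size λ ≥ c·ln n, started from an arbitrary population P₀ ∈ X^λ, the expected number of iterations until the population contains at least γ₀·λ individuals x with |x| ≥ n−r is at most C·n. -/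

import Mathlib

open scoped ENNReal

/-- Bit strings of length `n`: the search space `{0,1}^n`. -/
abbrev BitStr (n : ℕ) := Fin n → Bool

/-- Populations of `l` individuals from `{0,1}^n`. -/
abbrev Popn (n l : ℕ) := Fin l → BitStr n

/-- The number of one-bits `|x|` of a bit string. -/
def ones {n : ℕ} (x : BitStr n) : ℕ := (Finset.univ.filter fun i => x i = true).card

/-- The fitness function `Plateau_r`. -/
noncomputable def plateauF (n r : ℕ) (x : BitStr n) : ℝ :=
  if ones x ≤ n - r then (ones x : ℝ)
  else if ones x = n then (n : ℝ)
  else ((n - r : ℕ) : ℝ)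

/-- The all-ones string, the unique global optimum of `Plateau_r`. -/
def allOnesStr (n : ℕ) : BitStr n := fun _ => true

/-- Product of finitely many PMFs: the coordinates are independent. -/
noncomputable def prodPMF {ι α : Type*} [Fintype ι] [DecidableEq ι] [Fintype α]
    (p : ι → PMF α) : PMF (ι → α) :=
  PMF.ofFintype (fun g => ∏ i, p i (g i))
    (by
      have h1 : ∀ i : ι, ∑ a : α, p i a = 1 := fun i => by
        simpa [tsum_fintype] using (p i).tsum_coe
      calc ∑ g : ι → α, ∏ i, p i (g i)
          = ∏ i : ι, ∑ a : α, p i a := by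
            rw [Finset.prod_univ_sum, Fintype.piFinset_univ]
        _ = 1 := by simp [h1])

/-- One generation of the non-elitist EA: each of the `l` individuals of the
next population is sampled independently by first drawing a parent index via
the selection mechanism `sel` and then mutating the parent via `mutOp`. -/
noncomputable def eaStep {n l : ℕ} (sel : Popn n l → PMF (Fin l))
    (mutOp : BitStr n → PMF (BitStr n)) (P : Popn n l) : PMF (Popn n l) :=
  prodPMF fun _ : Fin l => (sel P).bind fun i => mutOp (P i)

/-- `t`-fold iteration of the EA transition kernel. -/
noncomputable def iterStep {n l : ℕ} (step : Popn n l → PMF (Popn n l)) :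
    ℕ → Popn n l → PMF (Popn n l)
  | 0 => fun P => PMF.pure P
  | (t + 1) => fun P => (step P).bind (iterStep step t)

/-- `notYet init step G t P` is the probability that the Markov chain with initial
distribution `init` and transition kernel `step` avoids the set `G` at all
times `0,…,t` and is at `P` at time `t`. -/
noncomputable def notYet {n l : ℕ} (init : PMF (Popn n l))
    (step : Popn n l → PMF (Popn n l)) (G : Set (Popn n l)) :
    ℕ → Popn n l → ℝ≥0∞
  | 0 => Gᶜ.indicator fun P => init P
  | (t + 1) => Gᶜ.indicator fun P => ∑ Q : Popn n l, notYet init step G t Q * step Q P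

/-- The probability that the chain avoids `G` at all times `0,…,t`,
i.e. `Pr(T > t)` where `T` is the first hitting time of `G`. -/
noncomputable def survProb {n l : ℕ} (init : PMF (Popn n l))
    (step : Popn n l → PMF (Popn n l)) (G : Set (Popn n l)) (t : ℕ) : ℝ≥0∞ :=
  ∑ P : Popn n l, notYet init step G t P

/-- The probability that the chain visits `G` at some time in `{0,…,t}`,
i.e. `Pr(T ≤ t)` where `T` is the first hitting time of `G`. -/
noncomputable def hitProb {n l : ℕ} (init : PMF (Popn n l))
    (step : Popn n l → PMF (Popn n l)) (G : Set (Popn n l)) (t : ℕ) : ℝ≥0∞ :=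
  1 - survProb init step G t

/-- The expected first hitting time of `G`:
`E[T] = ∑_{t≥0} Pr(T > t)` where `T = min { t | P_t ∈ G }`. -/
noncomputable def expHitTime {n l : ℕ} (init : PMF (Popn n l))
    (step : Popn n l → PMF (Popn n l)) (G : Set (Popn n l)) : ℝ≥0∞ :=
  ∑' t : ℕ, survProb init step G t

/-- Populations containing the global optimum (the all-ones string). -/
def optSet (n l : ℕ) : Set (Popn n l) := {P | ∃ i, P i = allOnesStr n}

/-- `mutOp` is the bitwise mutation operator with mutation probability `p`:
each of the `n` bits is flipped independently with probability `p`. -/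
def IsBitwiseMut {n : ℕ} (p : ℝ) (mutOp : BitStr n → PMF (BitStr n)) : Prop :=
  ∀ x y : BitStr n,
    mutOp x y = ENNReal.ofReal (p ^ hammingDist x y * (1 - p) ^ (n - hammingDist x y))

/-- `mutOp` is an unbiased mutation operator: `p_mut(y|x)` depends only on the
Hamming distance `H(x,y)`. -/
def IsUnbiasedMut {n : ℕ} (mutOp : BitStr n → PMF (BitStr n)) : Prop :=
  ∀ x y x' y' : BitStr n, hammingDist x y = hammingDist x' y' → mutOp x y = mutOp x' y'

/-- `Pr(ξ = d)`: the probability that exactly `d` bits are flipped when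
mutating `x`. -/
noncomputable def flipProb {n : ℕ} (mutOp : BitStr n → PMF (BitStr n))
    (x : BitStr n) (d : ℕ) : ℝ≥0∞ :=
  ∑ y ∈ Finset.univ.filter (fun y : BitStr n => hammingDist x y = d), mutOp x y

/-- `sel` is `k`-tournament selection for fitness `f`: `k` indices are drawn
uniformly at random with replacement, and an index of maximal fitness among
those drawn is returned (ties broken arbitrarily, encoded by `pick`). -/
def IsTournamentSel {n l : ℕ} (f : BitStr n → ℝ) (k : ℕ)
    (sel : Popn n l → PMF (Fin l)) : Prop :=
  ∀ P : Popn n l, ∃ pick : (Fin k → Fin l) → Fin l → ℝ≥0∞,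
    (∀ d, ∑ i, pick d i = 1) ∧
    (∀ d i, pick d i ≠ 0 → (∃ j, d j = i) ∧ ∀ j, f (P (d j)) ≤ f (P i)) ∧
    (∀ i, sel P i = (∑ d : Fin k → Fin l, pick d i) / (l : ℝ≥0∞) ^ k)

/-- `sel` is `(μ,λ)`-selection for fitness `f`: a uniformly random index among
the `μ` fittest individuals of the population is returned (ties broken
arbitrarily, encoded by the choice of `S`). -/
def IsMuCommaSel {n l : ℕ} (f : BitStr n → ℝ) (μ : ℕ)
    (sel : Popn n l → PMF (Fin l)) : Prop :=
  ∀ P : Popn n l, ∃ S : Finset (Fin l), S.card = μ ∧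
    (∀ i ∈ S, ∀ j, j ∉ S → f (P j) ≤ f (P i)) ∧
    (∀ i, sel P i = if i ∈ S then ((μ : ℝ≥0∞))⁻¹ else 0)

/-- `sel` is fitness-proportionate selection for fitness `f`. -/
def IsPropSel {n l : ℕ} (f : BitStr n → ℝ) (sel : Popn n l → PMF (Fin l)) : Prop :=
  ∀ P : Popn n l, ∀ i : Fin l,
    ((∑ j, f (P j)) = 0 → sel P i = ((l : ℝ≥0∞))⁻¹) ∧
    ((∑ j, f (P j)) ≠ 0 → sel P i = ENNReal.ofReal (f (P i) / ∑ j, f (P j)))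

/-- `sel` is an `f`-monotone selection mechanism. -/
def IsMonotoneSel {n l : ℕ} (f : BitStr n → ℝ) (sel : Popn n l → PMF (Fin l)) : Prop :=
  ∀ P : Popn n l, ∀ i j : Fin l, (sel P j ≤ sel P i ↔ f (P j) ≤ f (P i))

/-! ### Generic product-law facts -/

/-- Additive drift theorem for the survival formulation. -/
lemma drift_ennreal {n l : ℕ} (P₀ : Popn n l) (step : Popn n l → PMF (Popn n l))
    (G : Set (Popn n l)) (g : Popn n l → ℝ≥0∞)
    (hd : ∀ P, P ∉ G → ∑ Q, step P Q * g Q + 1 ≤ g P) :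
    expHitTime (PMF.pure P₀) step G ≤ g P₀ := by
  have key : ∀ t, ∑ P, notYet (PMF.pure P₀) step G (t+1) P * g P
      + survProb (PMF.pure P₀) step G t ≤ ∑ P, notYet (PMF.pure P₀) step G t P * g P := by
    intro t
    have hz : ∀ Q, Q ∈ G → notYet (PMF.pure P₀) step G t Q = 0 := by
      intro Q hQ
      cases t <;> simp [notYet, hQ]
    calc _ ≤ ∑ P, (∑ Q, notYet (PMF.pure P₀) step G t Q * step Q P) * g P
            + survProb (PMF.pure P₀) step G t := by
          gcongr with P
          simp only [notYet]
          exact Set.indicator_le_self' (fun _ _ => zero_le) P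
      _ = ∑ Q, notYet (PMF.pure P₀) step G t Q * (∑ P, step Q P * g P + 1) := by
          simp only [survProb, mul_add, mul_one, Finset.sum_add_distrib, Finset.sum_mul,
            Finset.mul_sum]
          rw [Finset.sum_comm]
          simp only [mul_assoc]
      _ ≤ _ := by
          apply Finset.sum_le_sum
          intro Q _
          by_cases hQ : Q ∈ G
          · simp [hz Q hQ]
          · gcongr
            exact hd Q hQ
  have part : ∀ T, ∑ t ∈ Finset.range T, survProb (PMF.pure P₀) step G t
      + ∑ P, notYet (PMF.pure P₀) step G T P * g P ≤ g P₀ := by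
    intro T
    induction T with
    | zero =>
      simp only [Finset.range_zero, Finset.sum_empty, zero_add, notYet]
      calc _ ≤ ∑ P, (PMF.pure P₀) P * g P := by
            gcongr with P
            exact Set.indicator_le_self' (fun _ _ => zero_le) P
        _ = g P₀ := by
            simp [PMF.pure_apply]
    | succ T ih =>
      rw [Finset.sum_range_succ, add_assoc, add_comm (survProb _ _ _ _)]
      exact le_trans (by gcongr; exact key T) ih
  rw [expHitTime, ENNReal.tsum_eq_iSup_nat]
  exact iSup_le fun T => le_trans le_self_add (part T)

/-- Generating function of the number of coordinates in `A` under a product law. -/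
lemma gen_fun {α : Type*} [Fintype α] (p : α → ℝ) (hp1 : ∑ a, p a = 1)
    (A : α → Prop) [DecidablePred A] (l : ℕ) (s : ℝ) :
    ∑ P : Fin l → α, (∏ i, p (P i)) * s ^ (Finset.univ.filter fun i => A (P i)).card
      = (1 - (∑ a with A a, p a) + (∑ a with A a, p a) * s) ^ l := by
  have h1 : ∀ P : Fin l → α, (∏ i, p (P i)) * s ^ (Finset.univ.filter fun i => A (P i)).card
      = ∏ i, (p (P i) * if A (P i) then s else 1) := by
    intro P
    rw [Finset.prod_mul_distrib, Finset.prod_ite]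
    simp
  have h2 : ∑ a, (p a * if A a then s else 1)
      = 1 - (∑ a with A a, p a) + (∑ a with A a, p a) * s := by
    have h3 := Finset.sum_filter_add_sum_filter_not Finset.univ A p
    rw [hp1] at h3
    have h4 : 1 - (∑ a with A a, p a) = ∑ a with ¬ A a, p a := by linarith
    rw [← Finset.sum_filter_add_sum_filter_not Finset.univ A, h4, Finset.sum_mul]
    rw [add_comm]
    congr 1
    · apply Finset.sum_congr rfl
      intro a ha
      simp [(Finset.mem_filter.mp ha).2]
    · apply Finset.sum_congr rfl
      intro a ha
      simp [(Finset.mem_filter.mp ha).2]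
  simp_rw [h1]
  rw [← h2]
  have := Finset.prod_univ_sum (fun _ : Fin l => (Finset.univ : Finset α))
    (fun _ a => p a * if A a then s else 1)
  rw [Fintype.piFinset_univ] at this
  rw [← this]
  simp

/-- Laplace transform bound. -/
lemma mgf_le {α : Type*} [Fintype α] (p : α → ℝ) (hp0 : ∀ a, 0 ≤ p a) (hp1 : ∑ a, p a = 1)
    (A : α → Prop) [DecidablePred A] (l : ℕ) (η : ℝ) :
    ∑ P : Fin l → α, (∏ i, p (P i)) *
        Real.exp (-(η * (Finset.univ.filter fun i => A (P i)).card))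
      ≤ Real.exp (-(l * (∑ a with A a, p a) * (1 - Real.exp (-η)))) := by
  have h := gen_fun p hp1 A l (Real.exp (-η))
  have hq1 : ∑ a with A a, p a ≤ 1 := by
    rw [← hp1]
    exact Finset.sum_le_sum_of_subset_of_nonneg (Finset.filter_subset _ _) (fun a _ _ => hp0 a)
  have hq0 : 0 ≤ ∑ a with A a, p a := Finset.sum_nonneg fun a _ => hp0 a
  set q := ∑ a with A a, p a
  have e1 : ∀ m : ℕ, Real.exp (-(η * m)) = Real.exp (-η) ^ m := by
    intro m
    rw [← Real.exp_nat_mul]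
    congr 1; ring
  simp_rw [e1]
  rw [h]
  have : 1 - q + q * Real.exp (-η) ≤ Real.exp (-(q * (1 - Real.exp (-η)))) := by
    have := Real.add_one_le_exp (-(q * (1 - Real.exp (-η))))
    linarith
  calc _ ≤ (Real.exp (-(q * (1 - Real.exp (-η))))) ^ l := by
        apply pow_le_pow_left₀ _ this
        have := Real.exp_pos (-η)
        nlinarith
    _ = _ := by
      rw [← Real.exp_nat_mul]
      congr 1; ring

/-- First inverse moment bound. -/
lemma inv_moment_le {α : Type*} [Fintype α] (p : α → ℝ) (hp0 : ∀ a, 0 ≤ p a)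
    (hp1 : ∑ a, p a = 1)
    (A : α → Prop) [DecidablePred A] (l : ℕ) (hq : 0 < ∑ a with A a, p a) :
    ∑ P : Fin l → α, (∏ i, p (P i)) *
        (1 / (((Finset.univ.filter fun i => A (P i)).card : ℝ) + 1))
      ≤ 1 / ((l + 1) * (∑ a with A a, p a)) := by
  have hq1 : ∑ a with A a, p a ≤ 1 := by
    rw [← hp1]
    exact Finset.sum_le_sum_of_subset_of_nonneg (Finset.filter_subset _ _) (fun a _ _ => hp0 a)
  have h := fun s => gen_fun p hp1 A l s
  set q := ∑ a with A a, p a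
  have hint : ∫ s in (0:ℝ)..1, ∑ P : Fin l → α, (∏ i, p (P i)) *
      s ^ (Finset.univ.filter fun i => A (P i)).card
      = ∑ P : Fin l → α, (∏ i, p (P i)) *
        (1 / (((Finset.univ.filter fun i => A (P i)).card : ℝ) + 1)) := by
    rw [intervalIntegral.integral_finsetSum]
    · apply Finset.sum_congr rfl
      intro P _
      rw [intervalIntegral.integral_const_mul, integral_pow]
      simp
    · intro P _
      apply Continuous.intervalIntegrable
      fun_prop
  rw [← hint]
  simp_rw [h]
  have hd : ∀ s ∈ Set.uIcc (0:ℝ) 1,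
      HasDerivAt (fun s : ℝ => (1 - q + q * s) ^ (l+1) / ((l+1) * q)) ((1 - q + q * s) ^ l) s := by
    intro s _
    have h1 : HasDerivAt (fun s : ℝ => 1 - q + q * s) q s := by
      simpa using ((hasDerivAt_id s).const_mul q).const_add (1 - q)
    have h2 := (h1.pow (l+1)).div_const ((l+1) * q)
    have hq' : q ≠ 0 := hq.ne'
    have hl' : (l:ℝ) + 1 ≠ 0 := by positivity
    have e : ((l + 1 : ℕ) : ℝ) * (1 - q + q * s) ^ (l + 1 - 1) * q / ((l + 1) * q)
        = (1 - q + q * s) ^ l := by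
      push_cast
      field_simp
    rw [e] at h2
    exact h2
  rw [intervalIntegral.integral_eq_sub_of_hasDerivAt hd
    (Continuous.intervalIntegrable (by fun_prop) _ _)]
  simp only [mul_one, sub_add_cancel, one_pow, mul_zero, add_zero]
  have : 0 ≤ (1 - q) ^ (l+1) / ((l+1) * q) := by
    have : 0 ≤ 1 - q := by linarith
    positivity
  linarith

lemma eta_bound (ε : ℝ) (hε : 0 < ε) (hε1 : ε ≤ 1) :
    (1 + ε / 2) * (ε / 2) ≤ (1 + ε) * (1 - Real.exp (-(ε / 2))) := by
  have h1 := Real.quadratic_le_exp_of_nonneg (x := ε / 2) (by linarith)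
  have h2 : Real.exp (-(ε/2)) ≤ 1 - ε/2 + (ε/2)^2/2 := by
    have h3 : Real.exp (-(ε/2)) * Real.exp (ε/2) = 1 := by
      rw [← Real.exp_add]; simp
    by_contra hcon
    push Not at hcon
    have hpos : 0 < 1 - ε/2 + (ε/2)^2/2 := by nlinarith
    have : (1 - ε/2 + (ε/2)^2/2) * (1 + ε/2 + (ε/2)^2/2) <
        Real.exp (-(ε/2)) * Real.exp (ε/2) := by
      apply mul_lt_mul hcon h1 (by positivity) (Real.exp_pos _).le
    rw [h3] at this
    nlinarith [sq_nonneg (ε^2)]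
  have h3 : 0 ≤ ε^2 * (1 - ε) := by
    have : 0 ≤ 1 - ε := by linarith
    positivity
  nlinarith [mul_le_mul_of_nonneg_left h2 (by linarith : (0:ℝ) ≤ 1 + ε)]

lemma aux_zero (u c E a : ℝ) (hu : 0 < u) (hc : 0 < c) (hc1 : c ≤ 1) (ha : 0 < a)
    (hE : E ≤ 1 / (1 + u * c)) (h2 : 2 ≤ a * c) :
    a * (1 + 1 / u) * E + 2 ≤ a * (1 + 1 / u) := by
  have k2 : c ≤ (1 + 1 / u) * (1 - 1 / (1 + u * c)) := by
    have e : (1 + 1 / u) * (1 - 1 / (1 + u * c)) = c * ((1 + u) / (1 + u * c)) := by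
      have : 1 + u * c ≠ 0 := by positivity
      field_simp
      ring
    rw [e]
    have : 1 ≤ (1 + u) / (1 + u * c) := by
      rw [le_div_iff₀ (by positivity)]
      nlinarith
    nlinarith
  have k3 : a * (1 + 1 / u) * E ≤ a * (1 + 1 / u) * (1 / (1 + u * c)) := by
    gcongr
  have k4 : a * c ≤ a * ((1 + 1 / u) * (1 - 1 / (1 + u * c))) := by gcongr
  linarith

lemma aux_small (ε y : ℝ) (hε : 0 < ε) (hy : 1 ≤ y) : (y + 1) / ((1 + ε) * y) - 1 ≤ 1 := by
  rw [sub_le_iff_le_add, div_le_iff₀ (by positivity)]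
  nlinarith

lemma aux_large (ε y b : ℝ) (hε : 0 < ε) (hε1 : ε ≤ 1) (hy : 1 ≤ y) (hyK : 2 / ε ≤ y)
    (hb : b = 8 / ε) : b * ((y + 1) / ((1 + ε) * y) - 1) ≤ -2 := by
  have k : (y + 1) / ((1 + ε) * y) - 1 ≤ - (ε / 4) := by
    rw [sub_le_iff_le_add, div_le_iff₀ (by positivity)]
    rw [div_le_iff₀ hε] at hyK
    nlinarith [mul_nonneg (by linarith : (0:ℝ) ≤ 1 - ε) (by positivity : 0 ≤ ε * y)]
  have hb0 : 0 ≤ b := by rw [hb]; positivity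
  have h8 : b * ε = 8 := by rw [hb]; field_simp
  have := mul_le_mul_of_nonneg_left k hb0
  linarith

set_option maxHeartbeats 1000000 in
lemma core_drift {α : Type*} [Fintype α] (p : α → ℝ) (hp0 : ∀ a, 0 ≤ p a)
    (hp1 : ∑ a, p a = 1) (A B : α → Prop) [DecidablePred A] [DecidablePred B]
    (l : ℕ) (hl : 0 < l) (ε η γ z a b W : ℝ) (hε : 0 < ε) (hε1 : ε ≤ 1) (hη : η = ε / 2)
    (hz : 0 < z) (hγ : 0 < γ) (x : ℕ)
    (hq1 : (1 + ε) * x ≤ l * ∑ a with A a, p a)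
    (hq2 : (1 + ε) * z ≤ ∑ a with A a, p a)
    (hqB : (1 + ε) * γ ≤ ∑ a with B a, p a)
    (ha : 0 < a)
    (hb : b = 8 / ε) (ha1 : 2 ≤ a * (1 - Real.exp (-η)))
    (ha2 : 2 + b ≤ a * Real.exp (-(η * (2 / ε))) * (1 - Real.exp (-(ε * η / 2))))
    (hW0 : 0 ≤ W) (hW : W * Real.exp (-(l * γ * (ε * η / 2))) ≤ 1) :
    ∑ P : Fin l → α, (∏ i, p (P i)) *
      (a * (1 + 1 / (l * z)) * Real.exp (-(η * (Finset.univ.filter fun i => A (P i)).card))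
        + b * Real.log ((l + 1) /
          (max ((Finset.univ.filter fun i => A (P i)).card : ℝ) (l * z) + 1))
        + W * Real.exp (η * γ * l) *
          Real.exp (-(η * (Finset.univ.filter fun i => B (P i)).card))) + 1
      ≤ a * (1 + 1 / (l * z)) * Real.exp (-(η * x))
        + b * Real.log ((l + 1) / (max (x : ℝ) (l * z) + 1)) := by
  have hη0 : 0 < η := by rw [hη]; linarith
  have hl' : (0:ℝ) < l := by exact_mod_cast hl
  have hlz : 0 < (l:ℝ) * z := by positivity
  have heta := eta_bound ε hε hε1
  replace heta : (1 + ε / 2) * η ≤ (1 + ε) * (1 - Real.exp (-η)) := by rw [hη]; exact heta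
  have hc1 : 0 < 1 - Real.exp (-η) := by
    have : Real.exp (-η) < 1 := by rw [Real.exp_lt_one_iff]; linarith
    linarith
  have hmA := mgf_le p hp0 hp1 A l η
  have hmB := mgf_le p hp0 hp1 B l η
  have hqpos : 0 < ∑ a with A a, p a := lt_of_lt_of_le (by positivity) hq2
  have hinv := inv_moment_le p hp0 hp1 A l hqpos
  set q := ∑ a with A a, p a
  set qB := ∑ a with B a, p a
  have hb0 : 0 < b := by rw [hb]; positivity
  have hprod0 : ∀ P : Fin l → α, 0 ≤ ∏ i, p (P i) := fun P => Finset.prod_nonneg fun i _ => hp0 _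
  have hprod1 : ∑ P : Fin l → α, ∏ i, p (P i) = 1 := by
    have := gen_fun p hp1 A l 1
    simpa using this
  -- third term
  have h3 : ∑ P : Fin l → α, (∏ i, p (P i)) * (W * Real.exp (η * γ * l) *
      Real.exp (-(η * (Finset.univ.filter fun i => B (P i)).card))) ≤ 1 := by
    have e : ∀ P : Fin l → α, (∏ i, p (P i)) * (W * Real.exp (η * γ * l) *
      Real.exp (-(η * (Finset.univ.filter fun i => B (P i)).card)))
      = (W * Real.exp (η * γ * l)) * ((∏ i, p (P i)) *
        Real.exp (-(η * (Finset.univ.filter fun i => B (P i)).card))) := fun P => by ring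
    simp_rw [e]
    rw [← Finset.mul_sum]
    refine le_trans (mul_le_mul_of_nonneg_left hmB (by positivity)) (le_trans ?_ hW)
    rw [mul_assoc, ← Real.exp_add]
    apply mul_le_mul_of_nonneg_left _ hW0
    apply Real.exp_le_exp.mpr
    have k1 : (l:ℝ) * ((1 + ε) * γ) * (1 - Real.exp (-η)) ≤ l * qB * (1 - Real.exp (-η)) := by
      gcongr
    have k2 : (l:ℝ) * γ * ((1 + ε / 2) * η) ≤ l * γ * ((1 + ε) * (1 - Real.exp (-η))) :=
      mul_le_mul_of_nonneg_left heta (by positivity)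
    linarith
  -- first term
  set D := 1 + 1 / ((l:ℝ) * z)
  have hD : 1 ≤ D := by
    have : 0 < 1 / ((l:ℝ) * z) := by positivity
    simp only [D]; linarith
  have h1 : ∑ P : Fin l → α, (∏ i, p (P i)) * (a * D *
      Real.exp (-(η * (Finset.univ.filter fun i => A (P i)).card)))
      ≤ a * D * Real.exp (-(l * q * (1 - Real.exp (-η)))) := by
    have e : ∀ P : Fin l → α, (∏ i, p (P i)) * (a * D *
      Real.exp (-(η * (Finset.univ.filter fun i => A (P i)).card)))
      = (a * D) * ((∏ i, p (P i)) *
        Real.exp (-(η * (Finset.univ.filter fun i => A (P i)).card))) := fun P => by ring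
    simp_rw [e]
    rw [← Finset.mul_sum]
    exact mul_le_mul_of_nonneg_left hmA (by positivity)
  have h1x : Real.exp (-(l * q * (1 - Real.exp (-η)))) ≤
      Real.exp (-(η * x)) * Real.exp (-(ε * η / 2 * x)) := by
    rw [← Real.exp_add]
    apply Real.exp_le_exp.mpr
    have k1 : ((1 + ε) * x) * (1 - Real.exp (-η)) ≤ l * q * (1 - Real.exp (-η)) := by
      gcongr
    have k2 : (x:ℝ) * ((1 + ε / 2) * η) ≤ x * ((1 + ε) * (1 - Real.exp (-η))) :=
      mul_le_mul_of_nonneg_left heta (by positivity)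
    linarith
  simp only [mul_add, Finset.sum_add_distrib]
  -- second term
  set y := max (x:ℝ) (l * z) with hy
  have hlog : ∀ u : ℝ, 0 ≤ u → ∀ v : ℝ, 0 ≤ v → Real.log ((l+1)/(u+1)) ≤
      Real.log ((l+1)/(v+1)) + ((v+1) * (1/(u+1)) - 1) := by
    intro u hu v hv
    have e : ((l:ℝ)+1)/(u+1) = (l+1)/(v+1) * ((v+1) * (1/(u+1))) := by field_simp
    rw [e, Real.log_mul (by positivity) (by positivity)]
    have := Real.log_le_sub_one_of_pos (x := (v+1) * (1/(u+1))) (by positivity)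
    linarith
  rcases Nat.eq_zero_or_pos x with hx0 | hx0
  · -- x = 0
    have h2 : ∑ P : Fin l → α, (∏ i, p (P i)) * (b * Real.log ((l + 1) /
          (max ((Finset.univ.filter fun i => A (P i)).card : ℝ) (l * z) + 1)))
        ≤ b * Real.log ((l + 1) / (y + 1)) := by
      calc _ ≤ ∑ P : Fin l → α, (∏ i, p (P i)) * (b * Real.log ((l + 1) / (y + 1))) := by
            apply Finset.sum_le_sum
            intro P _
            apply mul_le_mul_of_nonneg_left _ (hprod0 P)
            apply mul_le_mul_of_nonneg_left _ hb0.le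
            apply Real.log_le_log (by positivity)
            rw [hy, hx0]
            gcongr
            simp
        _ = _ := by rw [← Finset.sum_mul, hprod1, one_mul]
    have h4 : a * D * Real.exp (-(l * q * (1 - Real.exp (-η)))) + 2 ≤ a * D := by
      have k0 : (l:ℝ) * z * (1 - Real.exp (-η)) ≤ l * q * (1 - Real.exp (-η)) := by
        have : z ≤ q := by nlinarith only [hq2, hz, hε]
        gcongr
      apply aux_zero _ (1 - Real.exp (-η)) _ _ hlz hc1 _ ha _ ha1
      · have := Real.exp_pos (-η)
        linarith
      · rw [Real.exp_neg (_ * _), ← one_div]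
        apply one_div_le_one_div_of_le (by positivity)
        have := Real.add_one_le_exp (l * q * (1 - Real.exp (-η)))
        linarith
    have h5 : a * D * Real.exp (-(η * x)) = a * D := by simp [hx0]
    rw [h5]
    linarith
  · -- x ≥ 1
    have hx1 : (1:ℝ) ≤ x := by exact_mod_cast hx0
    have hy1 : 1 ≤ y := le_trans hx1 (le_max_left _ _)
    have hqy : (1 + ε) * y ≤ l * q := by
      rw [hy, mul_max_of_nonneg _ _ (by linarith)]
      apply max_le hq1
      calc (1 + ε) * (l * z) = l * ((1 + ε) * z) := by ring
        _ ≤ _ := by gcongr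
    have h2 : ∑ P : Fin l → α, (∏ i, p (P i)) * (b * Real.log ((l + 1) /
          (max ((Finset.univ.filter fun i => A (P i)).card : ℝ) (l * z) + 1)))
        ≤ b * (Real.log ((l + 1) / (y + 1)) + ((y + 1) / ((1 + ε) * y) - 1)) := by
      calc _ ≤ ∑ P : Fin l → α, (b * (Real.log ((l + 1) / (y + 1)) - 1) * (∏ i, p (P i)) +
              b * (y + 1) * ((∏ i, p (P i)) *
              (1 / (((Finset.univ.filter fun i => A (P i)).card : ℝ) + 1)))) := by
            apply Finset.sum_le_sum
            intro P _
            have k1 := hlog ((Finset.univ.filter fun i => A (P i)).card : ℝ) (by positivity)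
              y (by linarith)
            have k2 : Real.log ((l + 1) /
                (max ((Finset.univ.filter fun i => A (P i)).card : ℝ) (l * z) + 1)) ≤
                Real.log ((l + 1) / (((Finset.univ.filter fun i => A (P i)).card : ℝ) + 1)) := by
              apply Real.log_le_log (by positivity)
              gcongr
              exact le_max_left _ _
            have k3 := mul_le_mul_of_nonneg_left
              (mul_le_mul_of_nonneg_left (k2.trans k1) hb0.le) (hprod0 P)
            refine k3.trans (le_of_eq ?_)
            ring
        _ = b * (Real.log ((l + 1) / (y + 1)) - 1) + b * (y + 1) *
            ∑ P : Fin l → α, ((∏ i, p (P i)) *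
              (1 / (((Finset.univ.filter fun i => A (P i)).card : ℝ) + 1))) := by
            rw [Finset.sum_add_distrib, ← Finset.mul_sum, ← Finset.mul_sum, hprod1, mul_one]
        _ ≤ b * (Real.log ((l + 1) / (y + 1)) - 1) + b * (y + 1) * (1 / ((1 + ε) * y)) := by
            have k1 : 1 / (((l:ℝ) + 1) * q) ≤ 1 / ((1 + ε) * y) := by
              apply one_div_le_one_div_of_le (by positivity)
              nlinarith only [hqy, hqpos]
            have := hinv.trans k1
            gcongr
        _ = _ := by ring
    rcases lt_or_ge y (2 / ε) with hyK | hyK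
    · -- small y
      have k1 := aux_small ε y hε hy1
      have k2 : Real.exp (-(η * (2 / ε))) ≤ Real.exp (-(η * x)) := by
        apply Real.exp_le_exp.mpr
        have : (x:ℝ) ≤ 2 / ε := le_trans (le_max_left _ _) hyK.le
        have := mul_le_mul_of_nonneg_left this hη0.le
        linarith
      have k3 : Real.exp (-(ε * η / 2 * x)) ≤ Real.exp (-(ε * η / 2)) := by
        apply Real.exp_le_exp.mpr
        have : 0 < ε * η / 2 := by positivity
        nlinarith only [this, hx1]
      have k4 : 0 ≤ 1 - Real.exp (-(ε * η / 2)) := by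
        have : Real.exp (-(ε * η / 2)) ≤ 1 := by
          rw [Real.exp_le_one_iff]
          have : 0 < ε * η / 2 := by positivity
          linarith
        linarith
      have k5 : a * Real.exp (-(η * (2 / ε))) * (1 - Real.exp (-(ε * η / 2)))
          ≤ a * D * Real.exp (-(η * x)) * (1 - Real.exp (-(ε * η / 2 * x))) := by
        have : a ≤ a * D := le_mul_of_one_le_right ha.le hD
        gcongr
      have k6 : a * D * Real.exp (-(l * q * (1 - Real.exp (-η)))) ≤
          a * D * (Real.exp (-(η * x)) * Real.exp (-(ε * η / 2 * x))) := by gcongr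
      have k7 := mul_le_mul_of_nonneg_left k1 hb0.le
      rw [mul_add b] at h2
      linarith
    · -- large y
      have k1 := aux_large ε y b hε hε1 hy1 hyK hb
      have k3 : Real.exp (-(ε * η / 2 * x)) ≤ 1 := by
        rw [Real.exp_le_one_iff]
        have : 0 < ε * η / 2 * x := by positivity
        linarith
      have k6 : a * D * Real.exp (-(l * q * (1 - Real.exp (-η)))) ≤
          a * D * (Real.exp (-(η * x))) := by
        apply mul_le_mul_of_nonneg_left _ (by positivity)
        refine h1x.trans ?_
        exact mul_le_of_le_one_right (Real.exp_pos _).le k3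
      rw [mul_add b] at h2
      linarith

/-! ### Mutation and selection -/

lemma plateau_ge_iff {n r j : ℕ} (hj : j ≤ n - r) (x : BitStr n) :
    (j : ℝ) ≤ plateauF n r x ↔ j ≤ ones x := by
  unfold plateauF
  split_ifs with h1 h2
  · exact Nat.cast_le
  · rw [Nat.cast_le]
    omega
  · rw [Nat.cast_le]
    omega

lemma pmf_sum_real {α : Type*} [Fintype α] (p : PMF α) : ∑ a, (p a).toReal = 1 := by
  rw [← ENNReal.toReal_sum (fun a _ => p.apply_ne_top a)]
  have : ∑ a, p a = 1 := by simpa [tsum_fintype] using p.tsum_coe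
  simp [this]

lemma law_sum {n l : ℕ} (s : PMF (Fin l)) (m : Fin l → PMF (BitStr n))
    (A : BitStr n → Prop) [DecidablePred A] :
    ∑ x with A x, ((s.bind m) x).toReal
      = ∑ i, (s i).toReal * ∑ x with A x, (m i x).toReal := by
  have : ∀ x, ((s.bind m) x).toReal = ∑ i, (s i).toReal * (m i x).toReal := by
    intro x
    rw [PMF.bind_apply, tsum_fintype, ENNReal.toReal_sum]
    · simp [ENNReal.toReal_mul]
    · intro i _
      exact ENNReal.mul_ne_top (PMF.apply_ne_top _ _) (PMF.apply_ne_top _ _)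
  simp_rw [this, Finset.mul_sum]
  rw [Finset.sum_comm]

lemma mut_stay {n : ℕ} (mutOp : BitStr n → PMF (BitStr n)) (p₀ : ℝ) (x : BitStr n)
    (h : ENNReal.ofReal p₀ ≤ flipProb mutOp x 0) (A : BitStr n → Prop) [DecidablePred A]
    (hA : A x) : p₀ ≤ ∑ y with A y, (mutOp x y).toReal := by
  have h1 : flipProb mutOp x 0 = mutOp x x := by
    unfold flipProb
    rw [Finset.sum_eq_single x]
    · intro y hy hne
      simp at hy
      exact absurd hy.symm hne
    · simp
  rw [h1, ENNReal.ofReal_le_iff_le_toReal (PMF.apply_ne_top _ _)] at h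
  refine h.trans ?_
  exact Finset.single_le_sum (f := fun y => (mutOp x y).toReal)
    (fun y _ => ENNReal.toReal_nonneg) (by simp [hA])

lemma mut_up {n : ℕ} (hn : 0 < n) (mutOp : BitStr n → PMF (BitStr n)) (p₁ : ℝ) (x : BitStr n)
    (hu : IsUnbiasedMut mutOp) (h : ENNReal.ofReal p₁ ≤ flipProb mutOp x 1) :
    p₁ * (((n : ℝ) - ones x) / n) ≤ ∑ y with ones x + 1 ≤ ones y, (mutOp x y).toReal := by
  classical
  set fl : Fin n → BitStr n := fun i => Function.update x i (!x i) with hfl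
  have hinj : Function.Injective fl := by
    intro i k hik
    by_contra hne
    have := congrFun hik i
    simp [hfl, Function.update_of_ne hne] at this
  have hd : ∀ i, hammingDist x (fl i) = 1 := by
    intro i
    unfold hammingDist
    rw [Finset.card_eq_one]
    refine ⟨i, ?_⟩
    ext k
    by_cases hk : k = i
    · subst hk; simp [hfl]
    · simp [hfl, hk]
  have himg : Finset.univ.filter (fun y : BitStr n => hammingDist x y = 1)
      = Finset.univ.image fl := by
    ext y
    simp only [Finset.mem_filter, Finset.mem_univ, true_and, Finset.mem_image]
    constructor
    · intro hy
      unfold hammingDist at hy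
      rw [Finset.card_eq_one] at hy
      obtain ⟨i, hi⟩ := hy
      refine ⟨i, ?_⟩
      ext k
      have hk := Finset.ext_iff.mp hi k
      simp at hk
      by_cases hki : k = i
      · subst hki
        have : x k ≠ y k := hk.mpr rfl
        simp only [hfl, Function.update_self]
        revert this
        cases x k <;> cases y k <;> simp
      · have : x k = y k := by
          by_contra hc
          exact hki (hk.mp hc)
        simp [hfl, hki, this]
    · rintro ⟨i, rfl⟩
      exact hd i
  set u := (mutOp x (fl ⟨0, hn⟩)).toReal with hudef
  have hu' : ∀ i, mutOp x (fl i) = mutOp x (fl ⟨0, hn⟩) := fun i =>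
    hu _ _ _ _ (by rw [hd, hd])
  have hfp : flipProb mutOp x 1 = n * mutOp x (fl ⟨0, hn⟩) := by
    unfold flipProb
    rw [himg, Finset.sum_image (fun a _ b _ hab => hinj hab)]
    simp [hu']
  rw [hfp, ENNReal.ofReal_le_iff_le_toReal
    (ENNReal.mul_ne_top (by simp) (PMF.apply_ne_top _ _)), ENNReal.toReal_mul] at h
  simp only [ENNReal.toReal_natCast] at h
  have hu0 : 0 ≤ u := ENNReal.toReal_nonneg
  set Z := Finset.univ.filter fun i => x i = false with hZ
  have hZc : (Z.card : ℝ) = n - ones x := by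
    have : ones x + Z.card = n := by
      have := Finset.card_filter_add_card_filter_not (s := (Finset.univ : Finset (Fin n)))
        (fun i => x i = true)
      simpa [ones, hZ] using this
    have h' : (ones x : ℝ) + Z.card = n := by exact_mod_cast this
    linarith
  have hones : ∀ i ∈ Z, ones x + 1 ≤ ones (fl i) := by
    intro i hi
    have hxi : x i = false := by simpa [hZ] using hi
    unfold ones
    have : (Finset.univ.filter fun k => fl i k = true)
        = insert i (Finset.univ.filter fun k => x k = true) := by
      ext k
      by_cases hk : k = i
      · subst hk; simp [hfl, hxi]
      · simp [hfl, hk]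
    rw [this, Finset.card_insert_of_notMem]
    simp [hxi]
  have hlow : (Z.card : ℝ) * u ≤ ∑ y with ones x + 1 ≤ ones y, (mutOp x y).toReal := by
    calc (Z.card : ℝ) * u = ∑ y ∈ Z.image fl, (mutOp x y).toReal := by
          rw [Finset.sum_image (fun a _ b _ hab => hinj hab)]
          simp [hu', hudef]
      _ ≤ _ := by
          apply Finset.sum_le_sum_of_subset_of_nonneg
          · intro y hy
            obtain ⟨i, hi, rfl⟩ := Finset.mem_image.mp hy
            simpa using hones i hi
          · intro y _ _
            exact ENNReal.toReal_nonneg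
  refine le_trans ?_ hlow
  rw [hZc]
  have hn' : (0:ℝ) < n := by exact_mod_cast hn
  have hnn : 0 ≤ (n:ℝ) - ones x := by rw [← hZc]; positivity
  calc p₁ * (((n : ℝ) - ones x) / n) ≤ (n * u) * (((n : ℝ) - ones x) / n) := by gcongr
    _ = _ := by field_simp

/-- Numeric estimate for the tournament. -/
lemma tourn_numeric (p₀ δ ν w : ℝ) (k : ℕ) (hp : 0 < p₀) (hδ : 0 < δ) (hδ1 : δ ≤ 1)
    (hk : (1 + δ) / p₀ ≤ k) (hν0 : 0 ≤ ν) (hν : ν ≤ p₀ * δ / 6) (hw : ν ≤ w) (hw1 : w ≤ 1) :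
    (1 + δ / 2) * ν ≤ p₀ * (1 - (1 - w) ^ k) := by
  have h1 : (1 - w) ^ k ≤ Real.exp (-(w * k)) := by
    have := Real.add_one_le_exp (-w)
    calc (1 - w) ^ k ≤ (Real.exp (-w)) ^ k := by
          apply pow_le_pow_left₀ (by linarith)
          linarith
      _ = _ := by rw [← Real.exp_nat_mul]; congr 1; ring
  set t := (1 + δ) / p₀ * ν with ht
  have ht0 : 0 ≤ t := by positivity
  have h2 : Real.exp (-(w * k)) ≤ 1 / (1 + t) := by
    rw [Real.exp_neg, ← one_div]
    apply one_div_le_one_div_of_le (by positivity)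
    have h3 : t ≤ w * k := by
      rw [ht, mul_comm]
      apply mul_le_mul hw hk (by positivity) (by linarith)
    have := Real.add_one_le_exp (w * k)
    linarith
  have h4 : t ≤ δ / 3 := by
    calc t ≤ (1 + δ) / p₀ * (p₀ * δ / 6) := by rw [ht]; gcongr
      _ = (1 + δ) * δ / 6 := by field_simp
      _ ≤ δ / 3 := by nlinarith
  have h5 : p₀ * t = (1 + δ) * ν := by rw [ht]; field_simp
  have h6 : (1 + δ / 2) * ν ≤ p₀ * (1 - 1 / (1 + t)) := by
    have e : p₀ * (1 - 1 / (1 + t)) = ((1 + δ) * ν) / (1 + t) := by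
      rw [← h5]; field_simp; ring
    rw [e, le_div_iff₀ (by positivity)]
    have : (1 + δ / 2) * (1 + t) ≤ 1 + δ := by nlinarith
    nlinarith
  refine h6.trans ?_
  gcongr
  exact h1.trans h2

lemma tourn_lower {n l r k : ℕ} (hl : 0 < l) (p₀ δ : ℝ) (hp : 0 < p₀) (hδ : 0 < δ) (hδ1 : δ ≤ 1)
    (sel : Popn n l → PMF (Fin l)) (hk : (1 + δ) / p₀ ≤ (k : ℝ))
    (hs : IsTournamentSel (plateauF n r) k sel) (P : Popn n l) (j : ℕ) (hj : j ≤ n - r) :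
    (1 + δ / 2) * min (((Finset.univ.filter fun i => j ≤ ones (P i)).card : ℝ) / l) (p₀ * δ / 6)
      ≤ p₀ * ∑ i with j ≤ ones (P i), (sel P i).toReal := by
  obtain ⟨pick, h1, h2, h3⟩ := hs P
  set S := Finset.univ.filter fun i => j ≤ ones (P i) with hS
  have hl' : (0:ℝ) < l := by exact_mod_cast hl
  have hScard : (S.card : ℝ) ≤ l := by
    have := Finset.card_le_univ S
    simp only [Fintype.card_fin] at this
    exact_mod_cast this
  have hpk : ∀ d i, pick d i ≠ ⊤ := by
    intro d i htop
    have := Finset.single_le_sum (f := fun i => pick d i) (fun _ _ => zero_le) (Finset.mem_univ i)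
    rw [h1 d] at this
    simp [htop] at this
  have hsum : ∑ i ∈ S, (sel P i).toReal
      = (∑ d : Fin k → Fin l, ∑ i ∈ S, (pick d i).toReal) / (l:ℝ) ^ k := by
    rw [Finset.sum_comm, Finset.sum_div]
    apply Finset.sum_congr rfl
    intro i _
    rw [h3, ENNReal.toReal_div, ENNReal.toReal_sum (fun d _ => hpk d i)]
    simp
  have hpoint : ∀ d : Fin k → Fin l,
      (1:ℝ) - (if ∀ t, d t ∉ S then 1 else 0) ≤ ∑ i ∈ S, (pick d i).toReal := by
    intro d
    split_ifs with hd
    · simp only [sub_self]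
      exact Finset.sum_nonneg fun _ _ => ENNReal.toReal_nonneg
    · push Not at hd
      obtain ⟨t, ht⟩ := hd
      have htS : j ≤ ones (P (d t)) := by simpa [hS] using ht
      have hzero : ∀ i, i ∉ S → pick d i = 0 := by
        intro i hi
        by_contra hne
        have h5 := (h2 d i hne).2 t
        apply hi
        have h6 := (plateau_ge_iff hj (P (d t))).mpr htS
        have h7 := (plateau_ge_iff hj (P i)).mp (h6.trans h5)
        simpa [hS] using h7
      have hfull : ∑ i ∈ S, pick d i = 1 := by
        rw [← h1 d]
        apply Finset.sum_subset (Finset.subset_univ S)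
        intro i _ hi
        exact hzero i hi
      rw [← ENNReal.toReal_sum (fun i _ => hpk d i), hfull]
      simp
  have hcount : ∑ d : Fin k → Fin l, (if ∀ t, d t ∉ S then (1:ℝ) else 0)
      = ((l:ℝ) - S.card) ^ k := by
    have e : (Finset.univ.filter fun d : Fin k → Fin l => ∀ t, d t ∉ S)
        = Fintype.piFinset fun _ : Fin k => Sᶜ := by
      ext d; simp [Fintype.mem_piFinset]
    rw [Finset.sum_boole, e, Fintype.card_piFinset]
    simp only [Finset.prod_const, Finset.card_univ, Fintype.card_fin, Finset.card_compl]
    push_cast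
    rw [Nat.cast_sub (by exact_mod_cast hScard)]
  have hbig : 1 - (1 - (S.card : ℝ) / l) ^ k ≤ ∑ i ∈ S, (sel P i).toReal := by
    rw [hsum, le_div_iff₀ (by positivity)]
    calc (1 - (1 - (S.card : ℝ) / l) ^ k) * (l:ℝ) ^ k
        = (l:ℝ) ^ k - ((l:ℝ) - S.card) ^ k := by
          rw [sub_mul, one_mul, ← mul_pow]
          congr 2
          field_simp
      _ = ∑ d : Fin k → Fin l, ((1:ℝ) - (if ∀ t, d t ∉ S then 1 else 0)) := by
          rw [Finset.sum_sub_distrib, hcount]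
          simp
      _ ≤ _ := Finset.sum_le_sum fun d _ => hpoint d
  refine le_trans (tourn_numeric p₀ δ _ ((S.card : ℝ) / l) k hp hδ hδ1 hk ?_ (min_le_right _ _)
    (min_le_left _ _) ?_) (mul_le_mul_of_nonneg_left hbig hp.le)
  · apply le_min <;> positivity
  · rw [div_le_one hl']; exact hScard

lemma muc_lower {n l r μ : ℕ} (hl : 0 < l) (p₀ δ : ℝ) (hp : 0 < p₀) (hδ : 0 < δ) (hδ1 : δ ≤ 1)
    (sel : Popn n l → PMF (Fin l)) (hμ0 : 0 < μ) (hμ : (1 + δ) / p₀ ≤ (l : ℝ) / (μ : ℝ))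
    (hs : IsMuCommaSel (plateauF n r) μ sel) (P : Popn n l) (j : ℕ) (hj : j ≤ n - r) :
    (1 + δ / 2) * min (((Finset.univ.filter fun i => j ≤ ones (P i)).card : ℝ) / l) (p₀ * δ / 6)
      ≤ p₀ * ∑ i with j ≤ ones (P i), (sel P i).toReal := by
  obtain ⟨T, h1, h2, h3⟩ := hs P
  set S := Finset.univ.filter fun i => j ≤ ones (P i) with hS
  have hl' : (0:ℝ) < l := by exact_mod_cast hl
  have hμ' : (0:ℝ) < μ := by exact_mod_cast hμ0
  have hsum : ∑ i ∈ S, (sel P i).toReal = ((S ∩ T).card : ℝ) / μ := by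
    simp_rw [h3]
    have : ∀ i, (if i ∈ T then ((μ : ℝ≥0∞))⁻¹ else 0).toReal
        = if i ∈ T then ((μ : ℝ))⁻¹ else 0 := by
      intro i; split_ifs <;> simp
    simp_rw [this]
    rw [Finset.sum_ite_mem]
    simp [div_eq_mul_inv]
  rw [hsum]
  by_cases hTS : T ⊆ S
  · rw [Finset.inter_eq_right.mpr hTS, h1, div_self hμ'.ne', mul_one]
    calc _ ≤ (1 + δ / 2) * (p₀ * δ / 6) := by
          gcongr; exact min_le_right _ _
      _ ≤ p₀ := by nlinarith [mul_nonneg hp.le hδ.le]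
  · have hST : S ⊆ T := by
      obtain ⟨i, hiT, hiS⟩ := Finset.not_subset.mp hTS
      intro s hs
      by_contra hsT
      apply hiS
      have h5 := h2 i hiT s hsT
      have hs' : j ≤ ones (P s) := by simpa [hS] using hs
      have h6 := (plateau_ge_iff hj (P s)).mpr hs'
      simpa [hS] using (plateau_ge_iff hj (P i)).mp (h6.trans h5)
    rw [Finset.inter_eq_left.mpr hST]
    calc _ ≤ (1 + δ) * ((S.card : ℝ) / l) := by
          gcongr
          · linarith
          · exact min_le_left _ _
      _ = p₀ * ((1 + δ) / p₀) * ((S.card : ℝ) / l) := by field_simp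
      _ ≤ p₀ * ((l:ℝ) / μ) * ((S.card : ℝ) / l) := by gcongr
      _ = _ := by field_simp

/-! ### Offspring probabilities -/

/-- Number of individuals with at least `j` one-bits. -/
def cntGe {n l : ℕ} (P : Popn n l) (j : ℕ) : ℕ :=
  (Finset.univ.filter fun i : Fin l => j ≤ ones (P i)).card

lemma cntGe_le {n l : ℕ} (P : Popn n l) (j : ℕ) : cntGe P j ≤ l := by
  have := Finset.card_le_univ (Finset.univ.filter fun i : Fin l => j ≤ ones (P i))
  simpa [cntGe] using this

lemma cntGe_zero {n l : ℕ} (P : Popn n l) : cntGe P 0 = l := by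
  simp [cntGe]

lemma off_stay {n l : ℕ} (s : PMF (Fin l)) (mutOp : BitStr n → PMF (BitStr n)) (P : Popn n l)
    (p₀ : ℝ) (hm : ∀ x : BitStr n, ENNReal.ofReal p₀ ≤ flipProb mutOp x 0) (j : ℕ) :
    p₀ * ∑ i with j ≤ ones (P i), (s i).toReal
      ≤ ∑ x with j ≤ ones x, ((s.bind fun i => mutOp (P i)) x).toReal := by
  rw [law_sum, Finset.mul_sum, Finset.sum_filter]
  apply Finset.sum_le_sum
  intro i _
  split_ifs with h
  · rw [mul_comm]
    exact mul_le_mul_of_nonneg_left (mut_stay mutOp p₀ (P i) (hm _) (fun y => j ≤ ones y) h)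
      ENNReal.toReal_nonneg
  · exact mul_nonneg ENNReal.toReal_nonneg (Finset.sum_nonneg fun _ _ => ENNReal.toReal_nonneg)

lemma off_up {n l : ℕ} (hn : 0 < n) (s : PMF (Fin l)) (mutOp : BitStr n → PMF (BitStr n))
    (P : Popn n l) (hu : IsUnbiasedMut mutOp)
    (p₀ p₁ : ℝ) (hp₀ : 0 < p₀) (hp₀1 : p₀ ≤ 1) (hp₁ : 0 < p₁) (hp₁1 : p₁ ≤ 1)
    (hm : ∀ x : BitStr n, ENNReal.ofReal p₀ ≤ flipProb mutOp x 0)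
    (hm1 : ∀ x : BitStr n, ENNReal.ofReal p₁ ≤ flipProb mutOp x 1) (j : ℕ) (hj : j ≤ n) :
    (p₀ * ∑ i with j ≤ ones (P i), (s i).toReal) * (p₁ * (((n:ℝ) - j) / n))
      ≤ ∑ x with j + 1 ≤ ones x, ((s.bind fun i => mutOp (P i)) x).toReal := by
  have hn' : (0:ℝ) < n := by exact_mod_cast hn
  have hj' : (j:ℝ) ≤ n := by exact_mod_cast hj
  have hfr0 : 0 ≤ ((n:ℝ) - j) / n := div_nonneg (by linarith) hn'.le
  have hfr1 : ((n:ℝ) - j) / n ≤ 1 := by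
    rw [div_le_one hn']
    have : (0:ℝ) ≤ j := by positivity
    linarith
  rw [law_sum, Finset.mul_sum, Finset.sum_filter, Finset.sum_mul]
  apply Finset.sum_le_sum
  intro i _
  have hs0 : 0 ≤ (s i).toReal := ENNReal.toReal_nonneg
  split_ifs with h
  · have key : p₀ * (p₁ * (((n:ℝ) - j) / n))
        ≤ ∑ y with j + 1 ≤ ones y, (mutOp (P i) y).toReal := by
      rcases Nat.lt_or_ge j (ones (P i)) with h1 | h1
      · refine le_trans ?_ (mut_stay mutOp p₀ (P i) (hm _) (fun y => j + 1 ≤ ones y) h1)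
        exact mul_le_of_le_one_right hp₀.le (mul_le_one₀ hp₁1 hfr0 hfr1)
      · have he : ones (P i) = j := le_antisymm h1 h
        have h2 := mut_up hn mutOp p₁ (P i) hu (hm1 _)
        rw [he] at h2
        refine le_trans ?_ h2
        exact mul_le_of_le_one_left (by positivity) hp₀1
    calc p₀ * (s i).toReal * (p₁ * (((n:ℝ) - j) / n))
        = (s i).toReal * (p₀ * (p₁ * (((n:ℝ) - j) / n))) := by ring
      _ ≤ _ := mul_le_mul_of_nonneg_left key hs0
  · rw [zero_mul]
    exact mul_nonneg ENNReal.toReal_nonneg (Finset.sum_nonneg fun _ _ => ENNReal.toReal_nonneg)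

/-! ### The potential -/

/-- In-level potential. -/
noncomputable def hpot (a b η : ℝ) (l : ℕ) (z : ℝ) (X : ℕ) : ℝ :=
  a * (1 + 1 / (l * z)) * Real.exp (-(η * X))
    + b * Real.log ((l + 1) / (max (X : ℝ) (l * z) + 1))

lemma hpot_nonneg (a b η : ℝ) (l : ℕ) (z : ℝ) (X : ℕ) (ha : 0 ≤ a) (hb : 0 ≤ b)
    (hz : 0 < z) (hz1 : z ≤ 1) (hX : X ≤ l) : 0 ≤ hpot a b η l z X := by
  unfold hpot
  apply add_nonneg (by positivity)
  apply mul_nonneg hb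
  apply Real.log_nonneg
  rw [one_le_div (by positivity)]
  have h1 : (X:ℝ) ≤ l := by exact_mod_cast hX
  have h2 : (l:ℝ) * z ≤ l := mul_le_of_le_one_right (by positivity) hz1
  have := max_le h1 h2
  linarith

lemma hpot_le (a b η : ℝ) (l : ℕ) (z : ℝ) (X : ℕ) (ha : 0 ≤ a) (hb : 0 ≤ b) (hη : 0 ≤ η)
    (hz : 0 < z) : hpot a b η l z X ≤ hpot a b η l z 0 := by
  unfold hpot
  gcongr
  · simp
  · simp

/-- Success parameter of level `j`. -/
noncomputable def zlev (γ p₁ : ℝ) (n j : ℕ) : ℝ := γ * (p₁ * (((n:ℝ) - j) / n))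

lemma zlev_pos (γ p₁ : ℝ) (n j : ℕ) (hγ : 0 < γ) (hp₁ : 0 < p₁) (hj : j < n) :
    0 < zlev γ p₁ n j := by
  unfold zlev
  have h1 : (j:ℝ) < n := by exact_mod_cast hj
  have h0 : (0:ℝ) ≤ j := by positivity
  have : 0 < (n:ℝ) - j := by linarith
  have : (0:ℝ) < n := by linarith
  positivity

lemma zlev_le (γ p₁ : ℝ) (n j : ℕ) (hγ : 0 < γ) (hγ1 : γ ≤ 1) (hp₁ : 0 < p₁) (hp₁1 : p₁ ≤ 1)
    (hj : j < n) : zlev γ p₁ n j ≤ 1 := by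
  unfold zlev
  have h1 : (j:ℝ) < n := by exact_mod_cast hj
  have h0 : (0:ℝ) ≤ j := by positivity
  have hn : (0:ℝ) < n := by linarith
  have hfr0 : 0 ≤ ((n:ℝ) - j) / n := div_nonneg (by linarith) hn.le
  have hfr1 : ((n:ℝ) - j) / n ≤ 1 := by
    rw [div_le_one hn]
    linarith
  exact mul_le_one₀ hγ1 (by positivity) (mul_le_one₀ hp₁1 hfr0 hfr1)

lemma sum_log_le (n : ℕ) (hn : 0 < n) :
    ∑ m ∈ Finset.range n, Real.log ((n:ℝ) / ((m:ℝ) + 1)) ≤ n := by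
  have hn' : (0:ℝ) < n := by exact_mod_cast hn
  have h1 : ∀ N : ℕ, ∑ m ∈ Finset.range N, Real.log ((m:ℝ) + 1) = Real.log (N.factorial) := by
    intro N
    induction N with
    | zero => simp
    | succ N ih =>
      rw [Finset.sum_range_succ, ih, Nat.factorial_succ]
      push_cast
      rw [Real.log_mul (by positivity) (by positivity)]
      ring
  have h2 : ∑ m ∈ Finset.range n, Real.log ((n:ℝ) / ((m:ℝ) + 1))
      = n * Real.log n - Real.log (n.factorial) := by
    rw [← h1 n]
    have : ∀ m ∈ Finset.range n, Real.log ((n:ℝ) / ((m:ℝ) + 1))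
        = Real.log n - Real.log ((m:ℝ) + 1) := fun m _ =>
      Real.log_div hn'.ne' (by positivity)
    rw [Finset.sum_congr rfl this, Finset.sum_sub_distrib]
    simp
  rw [h2]
  have h3 := Real.pow_div_factorial_le_exp (n:ℝ) hn'.le n
  have h4 := Real.log_le_log (by positivity) h3
  rw [Real.log_exp, Real.log_div (by positivity) (by positivity), Real.log_pow] at h4
  exact h4

lemma sum_inv_le (n : ℕ) :
    ∑ m ∈ Finset.range n, 1 / ((m:ℝ) + 1) ≤ 1 + Real.log n := by
  have h := harmonic_le_one_add_log n
  refine le_trans (le_of_eq ?_) h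
  unfold harmonic
  push_cast
  simp

lemma W_le (a b η γ p₁ c : ℝ) (n l : ℕ) (ha : 0 < a) (hb : 0 < b) (hγ : 0 < γ) (hγ1 : γ ≤ 1)
    (hp₁ : 0 < p₁) (hp₁1 : p₁ ≤ 1) (hc : 0 < c) (hn : 3 ≤ n) (hl : c * Real.log n ≤ l) :
    ∑ j ∈ Finset.range n, hpot a b η l (zlev γ p₁ n j) 0
      ≤ (a + b * Real.log (1 / (γ * p₁)) + b + 2 * a / (γ * p₁ * c)) * n := by
  have hn' : (3:ℝ) ≤ n := by exact_mod_cast hn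
  have hn0 : (0:ℝ) < n := by linarith
  have hlog1 : 1 ≤ Real.log n := by
    rw [Real.le_log_iff_exp_le hn0]
    have := Real.exp_one_lt_d9
    linarith
  have hl0 : (0:ℝ) < l := lt_of_lt_of_le (by positivity) hl
  have hgp : 0 < γ * p₁ := by positivity
  have hpt : ∀ j ∈ Finset.range n, hpot a b η l (zlev γ p₁ n j) 0 ≤
      (fun m : ℕ => a + b * Real.log (1 / (γ * p₁)) + b * Real.log ((n:ℝ) / ((m:ℝ) + 1))
        + a * n / (γ * p₁ * l) * (1 / ((m:ℝ) + 1))) (n - 1 - j) := by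
    intro j hj
    have hjn := Finset.mem_range.mp hj
    have hcast : ((n - 1 - j : ℕ) : ℝ) + 1 = (n:ℝ) - j := by
      have : (n - 1 - j) + 1 + j = n := by omega
      have : ((n - 1 - j : ℕ) : ℝ) + 1 + j = n := by exact_mod_cast this
      linarith
    simp only [hcast]
    have hz := zlev_pos γ p₁ n j hγ hp₁ hjn
    have hz1 := zlev_le γ p₁ n j hγ hγ1 hp₁ hp₁1 hjn
    have hnj : 0 < (n:ℝ) - j := by
      have : (j:ℝ) < n := by exact_mod_cast hjn
      linarith
    have e1 : 1 / (l * zlev γ p₁ n j) = n / (γ * p₁ * l) * (1 / ((n:ℝ) - j)) := by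
      unfold zlev; field_simp
    have e2 : Real.log (1 / zlev γ p₁ n j) =
        Real.log (1 / (γ * p₁)) + Real.log ((n:ℝ) / ((n:ℝ) - j)) := by
      rw [← Real.log_mul (by positivity) (by positivity)]
      congr 1
      unfold zlev; field_simp
    have e3 : Real.log (((l:ℝ) + 1) / (max ((0:ℕ):ℝ) (l * zlev γ p₁ n j) + 1))
        ≤ Real.log (1 / zlev γ p₁ n j) := by
      apply Real.log_le_log (by positivity)
      rw [div_le_div_iff₀ (by positivity) hz]
      have := le_max_right ((0:ℕ):ℝ) (l * zlev γ p₁ n j)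
      nlinarith
    rw [e2] at e3
    unfold hpot
    rw [e1]
    have := mul_le_mul_of_nonneg_left e3 hb.le
    have e4 : Real.exp (-(η * ((0:ℕ):ℝ))) = 1 := by simp
    rw [e4]
    calc _ ≤ a * (1 + ↑n / (γ * p₁ * ↑l) * (1 / (↑n - ↑j))) * 1 +
          b * (Real.log (1 / (γ * p₁)) + Real.log (↑n / (↑n - ↑j))) := by gcongr
      _ = _ := by ring
  refine (Finset.sum_le_sum hpt).trans ?_
  refine (le_of_eq (Finset.sum_range_reflect (fun m : ℕ =>
    a + b * Real.log (1 / (γ * p₁)) + b * Real.log ((n:ℝ) / ((m:ℝ) + 1))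
        + a * n / (γ * p₁ * l) * (1 / ((m:ℝ) + 1))) n)).trans ?_
  simp only [Finset.sum_add_distrib, ← Finset.mul_sum, Finset.sum_const, Finset.card_range,
    nsmul_eq_mul]
  have h1 := sum_log_le n (by omega)
  have h2 := sum_inv_le n
  have h3 : a * n / (γ * p₁ * l) * ∑ m ∈ Finset.range n, 1 / ((m:ℝ) + 1)
      ≤ 2 * a / (γ * p₁ * c) * n := by
    calc _ ≤ a * n / (γ * p₁ * l) * (2 * (l / c)) := by
          gcongr
          refine h2.trans ?_
          have : Real.log n ≤ l / c := by
            rw [le_div_iff₀ hc]; linarith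
          linarith
      _ = _ := by field_simp
  have h4 := mul_le_mul_of_nonneg_left h1 hb.le
  linarith

/-- Tail of the potential. -/
noncomputable def tailpot (w : ℕ → ℝ) (n j : ℕ) : ℝ := ∑ i ∈ Finset.Ico (j + 1) n, w i

/-- Current level. -/
noncomputable def levOf {n l : ℕ} (γ : ℝ) (r : ℕ) (P : Popn n l) : ℕ :=
  open Classical in Nat.findGreatest (fun j => γ * l ≤ (cntGe P j : ℝ)) (n - r)

/-- The global potential. -/
noncomputable def gpot {n l : ℕ} (a b η γ p₁ : ℝ) (r : ℕ) (P : Popn n l) : ℝ :=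
  tailpot (fun i => hpot a b η l (zlev γ p₁ n i) 0) n (levOf γ r P)
    + hpot a b η l (zlev γ p₁ n (levOf γ r P)) (cntGe P (levOf γ r P + 1))

lemma lev_le {n l : ℕ} (γ : ℝ) (r : ℕ) (P : Popn n l) : levOf γ r P ≤ n - r := by
  classical
  exact Nat.findGreatest_le _

lemma lev_spec {n l : ℕ} (γ : ℝ) (hγ1 : γ ≤ 1) (r : ℕ) (P : Popn n l) :
    γ * l ≤ (cntGe P (levOf γ r P) : ℝ) := by
  classical
  have h0 : γ * l ≤ (cntGe P 0 : ℝ) := by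
    rw [cntGe_zero]
    exact mul_le_of_le_one_left (by positivity) hγ1
  exact Nat.findGreatest_spec (P := fun j => γ * l ≤ (cntGe P j : ℝ)) (Nat.zero_le (n - r)) h0

lemma lev_greatest {n l : ℕ} (γ : ℝ) (r : ℕ) (P : Popn n l) (j : ℕ) (h : levOf γ r P < j)
    (hj : j ≤ n - r) : (cntGe P j : ℝ) < γ * l := by
  classical
  have := Nat.findGreatest_is_greatest (P := fun j => γ * l ≤ (cntGe P j : ℝ)) h hj
  exact not_le.mp this

lemma gpot_le_tail {n l : ℕ} (a b η γ p₁ : ℝ) (r : ℕ) (ha : 0 < a) (hb : 0 < b) (hη : 0 < η)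
    (hγ : 0 < γ) (hγ1 : γ ≤ 1) (hp₁ : 0 < p₁) (hp₁1 : p₁ ≤ 1) (hr : 0 < r) (hrn : r ≤ n)
    (P : Popn n l) (j : ℕ) (hj : j ≤ levOf γ r P) :
    gpot a b η γ p₁ r P ≤ ∑ i ∈ Finset.Ico j n, hpot a b η l (zlev γ p₁ n i) 0 := by
  have hlev := lev_le γ r P
  have hlt : levOf γ r P < n := by omega
  have h1 : gpot a b η γ p₁ r P ≤
      ∑ i ∈ Finset.Ico (levOf γ r P) n, hpot a b η l (zlev γ p₁ n i) 0 := by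
    rw [Finset.sum_eq_sum_Ico_succ_bot hlt, add_comm]
    unfold gpot tailpot
    gcongr
    exact hpot_le _ _ _ _ _ _ ha.le hb.le hη.le (zlev_pos _ _ _ _ hγ hp₁ hlt)
  refine h1.trans ?_
  apply Finset.sum_le_sum_of_subset_of_nonneg
  · exact Finset.Ico_subset_Ico_left hj
  · intro i hi _
    have := (Finset.mem_Ico.mp hi).2
    exact hpot_nonneg _ _ _ _ _ _ ha.le hb.le (zlev_pos _ _ _ _ hγ hp₁ this)
      (zlev_le _ _ _ _ hγ hγ1 hp₁ hp₁1 this) (Nat.zero_le _)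

lemma gpot_nonneg {n l : ℕ} (a b η γ p₁ : ℝ) (r : ℕ) (ha : 0 < a) (hb : 0 < b)
    (hγ : 0 < γ) (hγ1 : γ ≤ 1) (hp₁ : 0 < p₁) (hp₁1 : p₁ ≤ 1) (hr : 0 < r) (hrn : r ≤ n)
    (P : Popn n l) : 0 ≤ gpot a b η γ p₁ r P := by
  have hlev := lev_le γ r P
  have hlt : levOf γ r P < n := by omega
  have hh : ∀ i < n, ∀ X ≤ l, 0 ≤ hpot a b η l (zlev γ p₁ n i) X := fun i hi X hX =>
    hpot_nonneg _ _ _ _ _ _ ha.le hb.le (zlev_pos _ _ _ _ hγ hp₁ hi)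
      (zlev_le _ _ _ _ hγ hγ1 hp₁ hp₁1 hi) hX
  apply add_nonneg
  · exact Finset.sum_nonneg fun i hi => hh i (Finset.mem_Ico.mp hi).2 0 (Nat.zero_le _)
  · exact hh _ hlt _ (cntGe_le _ _)

set_option maxHeartbeats 1000000 in
lemma gpot_le {n l : ℕ} (a b η γ p₁ : ℝ) (r : ℕ) (ha : 0 < a) (hb : 0 < b) (hη : 0 < η)
    (hγ : 0 < γ) (hγ1 : γ ≤ 1) (hp₁ : 0 < p₁) (hp₁1 : p₁ ≤ 1) (hr : 0 < r) (hrn : r ≤ n)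
    (P : Popn n l) (j : ℕ) (hj : j ≤ n - r) :
    gpot a b η γ p₁ r P ≤ tailpot (fun i => hpot a b η l (zlev γ p₁ n i) 0) n j +
      (hpot a b η l (zlev γ p₁ n j) (cntGe P (j + 1)) +
      (∑ i ∈ Finset.range n, hpot a b η l (zlev γ p₁ n i) 0) * Real.exp (η * γ * l) *
        Real.exp (-(η * (cntGe P j : ℝ)))) := by
  have hh : ∀ i < n, ∀ X ≤ l, 0 ≤ hpot a b η l (zlev γ p₁ n i) X := fun i hi X hX =>
    hpot_nonneg _ _ _ _ _ _ ha.le hb.le (zlev_pos _ _ _ _ hγ hp₁ hi)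
      (zlev_le _ _ _ _ hγ hγ1 hp₁ hp₁1 hi) hX
  have hW : 0 ≤ ∑ i ∈ Finset.range n, hpot a b η l (zlev γ p₁ n i) 0 :=
    Finset.sum_nonneg fun i hi => hh i (Finset.mem_range.mp hi) 0 (Nat.zero_le _)
  have hX := hh j (by omega) (cntGe P (j+1)) (cntGe_le _ _)
  have ht : 0 ≤ tailpot (fun i => hpot a b η l (zlev γ p₁ n i) 0) n j :=
    Finset.sum_nonneg fun i hi => hh i (Finset.mem_Ico.mp hi).2 0 (Nat.zero_le _)
  set W := ∑ i ∈ Finset.range n, hpot a b η l (zlev γ p₁ n i) 0 with hWdef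
  have hE : 0 ≤ W * Real.exp (η * γ * l) * Real.exp (-(η * (cntGe P j : ℝ))) :=
    mul_nonneg (mul_nonneg hW (Real.exp_pos _).le) (Real.exp_pos _).le
  rcases lt_trichotomy (levOf γ r P) j with h | h | h
  · have h1 := lev_greatest γ r P j h hj
    have h2 := gpot_le_tail a b η γ p₁ r ha hb hη hγ hγ1 hp₁ hp₁1 hr hrn P 0 (Nat.zero_le _)
    rw [← Finset.range_eq_Ico, ← hWdef] at h2
    have h3 : W ≤ W * Real.exp (η * γ * l) * Real.exp (-(η * (cntGe P j : ℝ))) := by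
      rw [mul_assoc, ← Real.exp_add]
      apply le_mul_of_one_le_right hW
      apply Real.one_le_exp
      have := mul_le_mul_of_nonneg_left h1.le hη.le
      linarith
    linarith
  · have : gpot a b η γ p₁ r P = tailpot (fun i => hpot a b η l (zlev γ p₁ n i) 0) n j +
      hpot a b η l (zlev γ p₁ n j) (cntGe P (j + 1)) := by
      unfold gpot
      rw [h]
    linarith
  · have h2 := gpot_le_tail a b η γ p₁ r ha hb hη hγ hγ1 hp₁ hp₁1 hr hrn P (j+1) h
    unfold tailpot
    linarith

lemma step_toReal {n l : ℕ} (sel : Popn n l → PMF (Fin l))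
    (mutOp : BitStr n → PMF (BitStr n)) (P Q : Popn n l) :
    (eaStep sel mutOp P Q).toReal
      = ∏ i, (((sel P).bind fun i => mutOp (P i)) (Q i)).toReal := by
  unfold eaStep prodPMF
  rw [PMF.ofFintype_apply, ENNReal.toReal_prod]

lemma drift_step {n l : ℕ} (a b ε η γ p₀ p₁ : ℝ) (r : ℕ) (ha : 0 < a)
    (hε : 0 < ε) (hε1 : ε ≤ 1) (hη : η = ε / 2)
    (hγ : 0 < γ) (hγ1 : γ ≤ 1) (hp₀ : 0 < p₀) (hp₀1 : p₀ ≤ 1) (hp₁ : 0 < p₁) (hp₁1 : p₁ ≤ 1)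
    (hr : 0 < r) (hrn : r ≤ n) (hl : 0 < l)
    (hb : b = 8 / ε) (ha1 : 2 ≤ a * (1 - Real.exp (-η)))
    (ha2 : 2 + b ≤ a * Real.exp (-(η * (2 / ε))) * (1 - Real.exp (-(ε * η / 2))))
    (hW : (∑ i ∈ Finset.range n, hpot a b η l (zlev γ p₁ n i) 0) *
      Real.exp (-(l * γ * (ε * η / 2))) ≤ 1)
    (sel : Popn n l → PMF (Fin l)) (mutOp : BitStr n → PMF (BitStr n))
    (hu : IsUnbiasedMut mutOp)
    (hm : ∀ x : BitStr n, ENNReal.ofReal p₀ ≤ flipProb mutOp x 0)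
    (hm1 : ∀ x : BitStr n, ENNReal.ofReal p₁ ≤ flipProb mutOp x 1)
    (hsel : ∀ P : Popn n l, ∀ j ≤ n - r, (1 + ε) * min ((cntGe P j : ℝ) / l) γ
      ≤ p₀ * ∑ i with j ≤ ones (P i), (sel P i).toReal)
    (P : Popn n l) (hP : (cntGe P (n - r) : ℝ) < γ * l) :
    ∑ Q, (eaStep sel mutOp P Q).toReal * gpot a b η γ p₁ r Q + 1 ≤ gpot a b η γ p₁ r P := by
  have hn : 0 < n := by omega
  have hl' : (0:ℝ) < l := by exact_mod_cast hl
  have hb0 : 0 < b := by rw [hb]; positivity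
  have hη0 : 0 < η := by rw [hη]; positivity
  have hlev := lev_le γ r P
  have hspec := lev_spec γ hγ1 r P
  set j := levOf γ r P with hj
  have hjlt : j < n - r := by
    rcases lt_or_eq_of_le hlev with h | h
    · exact h
    · rw [h] at hspec
      linarith
  have hx := lev_greatest γ r P (j+1) (by omega) (by omega)
  set law : BitStr n → ℝ := fun x => (((sel P).bind fun i => mutOp (P i)) x).toReal with hlaw
  have hB : (1 + ε) * γ ≤ p₀ * ∑ i with j ≤ ones (P i), (sel P i).toReal := by
    have := hsel P j hlev
    rwa [min_eq_right (by rw [le_div_iff₀ hl']; exact hspec)] at this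
  have hqB : (1 + ε) * γ ≤ ∑ x with j ≤ ones x, law x :=
    hB.trans (off_stay (sel P) mutOp P p₀ hm j)
  have hq1 : (1 + ε) * (cntGe P (j+1) : ℝ) ≤ l * ∑ x with j + 1 ≤ ones x, law x := by
    have h1 := hsel P (j+1) (by omega)
    rw [min_eq_left (by rw [div_le_iff₀ hl']; exact hx.le)] at h1
    have h2 := h1.trans (off_stay (sel P) mutOp P p₀ hm (j+1))
    calc (1 + ε) * (cntGe P (j+1) : ℝ) = l * ((1 + ε) * ((cntGe P (j+1) : ℝ) / l)) := by
          field_simp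
      _ ≤ _ := by gcongr
  have hjn : j < n := by omega
  have hq2 : (1 + ε) * zlev γ p₁ n j ≤ ∑ x with j + 1 ≤ ones x, law x := by
    have h1 := off_up hn (sel P) mutOp P hu p₀ p₁ hp₀ hp₀1 hp₁ hp₁1 hm hm1 j hjn.le
    refine le_trans ?_ h1
    unfold zlev
    rw [← mul_assoc]
    apply mul_le_mul_of_nonneg_right hB
    have : (j:ℝ) < n := by exact_mod_cast hjn
    have h3 : 0 < (n:ℝ) - j := by linarith
    positivity
  have hW0 : 0 ≤ ∑ i ∈ Finset.range n, hpot a b η l (zlev γ p₁ n i) 0 :=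
    Finset.sum_nonneg fun i hi => by
      have hi := Finset.mem_range.mp hi
      exact hpot_nonneg _ _ _ _ _ _ ha.le hb0.le (zlev_pos _ _ _ _ hγ hp₁ hi)
        (zlev_le _ _ _ _ hγ hγ1 hp₁ hp₁1 hi) (Nat.zero_le _)
  have core := core_drift law (fun _ => ENNReal.toReal_nonneg) (pmf_sum_real _)
    (fun x => j + 1 ≤ ones x) (fun x => j ≤ ones x) l hl ε η γ (zlev γ p₁ n j) a b
    (∑ i ∈ Finset.range n, hpot a b η l (zlev γ p₁ n i) 0) hε hε1 hη
    (zlev_pos _ _ _ _ hγ hp₁ hjn) hγ (cntGe P (j+1)) hq1 hq2 hqB ha hb ha1 ha2 hW0 hW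
  have hone : ∑ Q : Popn n l, ∏ i, law (Q i) = 1 := by
    have := gen_fun law (pmf_sum_real _) (fun x => j ≤ ones x) l 1
    simpa using this
  have hg : gpot a b η γ p₁ r P = tailpot (fun i => hpot a b η l (zlev γ p₁ n i) 0) n j +
      hpot a b η l (zlev γ p₁ n j) (cntGe P (j + 1)) := rfl
  rw [hg]
  simp_rw [step_toReal]
  calc _ ≤ ∑ Q : Popn n l, (∏ i, law (Q i)) *
        (tailpot (fun i => hpot a b η l (zlev γ p₁ n i) 0) n j +
      (hpot a b η l (zlev γ p₁ n j) (cntGe Q (j + 1)) +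
      (∑ i ∈ Finset.range n, hpot a b η l (zlev γ p₁ n i) 0) * Real.exp (η * γ * l) *
        Real.exp (-(η * (cntGe Q j : ℝ))))) + 1 := by
        gcongr with Q
        exact gpot_le a b η γ p₁ r ha hb0 hη0 hγ hγ1 hp₁ hp₁1 hr hrn Q j hlev
    _ = tailpot (fun i => hpot a b η l (zlev γ p₁ n i) 0) n j +
        (∑ Q : Popn n l, (∏ i, law (Q i)) *
      (hpot a b η l (zlev γ p₁ n j) (cntGe Q (j + 1)) +
      (∑ i ∈ Finset.range n, hpot a b η l (zlev γ p₁ n i) 0) * Real.exp (η * γ * l) *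
        Real.exp (-(η * (cntGe Q j : ℝ)))) + 1) := by
        simp_rw [mul_add (∏ i, law _) (tailpot _ _ _)]
        rw [Finset.sum_add_distrib, ← Finset.sum_mul, hone]
        ring
    _ ≤ _ := by
        gcongr
        exact core

/-- For the non-elitist EA on `Plateau_r` with an unbiased
mutation operator satisfying `Pr(ξ=0) ≥ p₀`, `Pr(ξ=1) ≥ p₁`, `k`-tournament
(`k ≥ (1+δ)/p₀`) or `(μ,λ)`-selection (`λ/μ ≥ (1+δ)/p₀`), and `λ ≥ c ln n`,
started from an arbitrary population, the expected number of iterations until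
at least `γ₀λ` individuals lie on the plateau (`|x| ≥ n−r`) is at most `Cn`. -/
theorem plateau_reach_plateau_fast
    (r : ℕ) (hr : 2 ≤ r) (p₀ p₁ δ : ℝ) (hp₀ : 0 < p₀) (hp₁ : 0 < p₁)
    (hδ0 : 0 < δ) (hδ1 : δ ≤ 1) :
    ∃ c C γ₀ : ℝ, 0 < c ∧ 0 < C ∧ 0 < γ₀ ∧ γ₀ < 1 ∧ ∃ n₀ : ℕ, ∀ n : ℕ, n₀ ≤ n →
      ∀ l : ℕ, ∀ sel : Popn n l → PMF (Fin l), ∀ mutOp : BitStr n → PMF (BitStr n),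
        IsUnbiasedMut mutOp →
        (∀ x : BitStr n, ENNReal.ofReal p₀ ≤ flipProb mutOp x 0) →
        (∀ x : BitStr n, ENNReal.ofReal p₁ ≤ flipProb mutOp x 1) →
        ((∃ k : ℕ, (1 + δ) / p₀ ≤ (k : ℝ) ∧ IsTournamentSel (plateauF n r) k sel) ∨
         (∃ μ : ℕ, 0 < μ ∧ (1 + δ) / p₀ ≤ (l : ℝ) / (μ : ℝ) ∧
            IsMuCommaSel (plateauF n r) μ sel)) →
        c * Real.log n ≤ (l : ℝ) →
        ∀ P₀ : Popn n l,
          expHitTime (PMF.pure P₀) (eaStep sel mutOp)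
              {P : Popn n l |
                γ₀ * l ≤ ((Finset.univ.filter fun i : Fin l => n - r ≤ ones (P i)).card : ℝ)}
            ≤ ENNReal.ofReal (C * n) := by
  by_cases hpp : p₀ ≤ 1 ∧ p₁ ≤ 1
  swap
  · refine ⟨1, 1, 1/2, one_pos, one_pos, by norm_num, by norm_num, 0, ?_⟩
    intro n _ l sel mutOp _ h0 h1 _ _ P₀
    exfalso
    have hfl : ∀ d, flipProb mutOp (allOnesStr n) d ≤ 1 := by
      intro d
      have : ∑ a, mutOp (allOnesStr n) a = 1 := by
        simpa [tsum_fintype] using (mutOp (allOnesStr n)).tsum_coe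
      rw [← this]
      exact Finset.sum_le_sum_of_subset (Finset.filter_subset _ _)
    apply hpp
    constructor
    · have := (h0 (allOnesStr n)).trans (hfl 0)
      rwa [ENNReal.ofReal_le_one] at this
    · have := (h1 (allOnesStr n)).trans (hfl 1)
      rwa [ENNReal.ofReal_le_one] at this
  obtain ⟨hp₀1, hp₁1⟩ := hpp
  obtain ⟨ε, hεd⟩ : ∃ ε, ε = δ / 2 := ⟨_, rfl⟩
  obtain ⟨η, hη⟩ : ∃ η, η = ε / 2 := ⟨_, rfl⟩
  obtain ⟨γ, hγd⟩ : ∃ γ, γ = p₀ * δ / 6 := ⟨_, rfl⟩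
  obtain ⟨b, hb⟩ : ∃ b, b = 8 / ε := ⟨_, rfl⟩
  have hε : 0 < ε := by rw [hεd]; positivity
  have hε1 : ε ≤ 1 := by rw [hεd]; linarith
  have hη0 : 0 < η := by rw [hη]; positivity
  have hγ : 0 < γ := by rw [hγd]; positivity
  have hγ1 : γ < 1 := by
    rw [hγd]
    have : p₀ * δ ≤ 1 := mul_le_one₀ hp₀1 hδ0.le hδ1
    linarith
  have hb0 : 0 < b := by rw [hb]; positivity
  have hc1 : 0 < 1 - Real.exp (-η) := by
    have : Real.exp (-η) < 1 := by rw [Real.exp_lt_one_iff]; linarith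
    linarith
  have hc2 : 0 < 1 - Real.exp (-(ε * η / 2)) := by
    have : Real.exp (-(ε * η / 2)) < 1 := by
      rw [Real.exp_lt_one_iff]
      have : 0 < ε * η / 2 := by positivity
      linarith
    linarith
  obtain ⟨a, ha, ha1, ha2⟩ : ∃ a : ℝ, 0 < a ∧ 2 ≤ a * (1 - Real.exp (-η)) ∧
      2 + b ≤ a * Real.exp (-(η * (2 / ε))) * (1 - Real.exp (-(ε * η / 2))) := by
    refine ⟨max (2 / (1 - Real.exp (-η)))
      ((2 + b) / (Real.exp (-(η * (2 / ε))) * (1 - Real.exp (-(ε * η / 2))))), ?_, ?_, ?_⟩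
    · exact lt_max_of_lt_left (by positivity)
    · rw [← div_le_iff₀ hc1]
      exact le_max_left _ _
    · rw [mul_assoc, ← div_le_iff₀ (by positivity)]
      exact le_max_right _ _
  obtain ⟨c, hcd⟩ : ∃ c, c = 4 / (γ * ε * η) := ⟨_, rfl⟩
  have hc : 0 < c := by rw [hcd]; positivity
  obtain ⟨C, hCd⟩ : ∃ C, C = a + b * Real.log (1 / (γ * p₁)) + b + 2 * a / (γ * p₁ * c) :=
    ⟨_, rfl⟩
  have hC : 0 < C := by
    have : 0 ≤ Real.log (1 / (γ * p₁)) := by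
      apply Real.log_nonneg
      rw [one_le_div (by positivity)]
      exact mul_le_one₀ hγ1.le hp₁.le hp₁1
    rw [hCd]
    positivity
  refine ⟨c, C, γ, hc, hC, hγ, hγ1, max 3 (max r ⌈C⌉₊), ?_⟩
  intro n hn l sel mutOp hu hm hm1 hs hl P₀
  have hn3 : 3 ≤ n := (le_max_left _ _).trans hn
  have hrn : r ≤ n := ((le_max_left _ _).trans (le_max_right _ _)).trans hn
  have hCn : C ≤ n := (Nat.le_ceil C).trans
    (by exact_mod_cast ((le_max_right _ _).trans (le_max_right _ _)).trans hn)
  have hn' : (3:ℝ) ≤ n := by exact_mod_cast hn3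
  have hn0 : (0:ℝ) < n := by linarith
  have hlog : 0 < Real.log n := Real.log_pos (by linarith)
  have hl0' : (0:ℝ) < l := lt_of_lt_of_le (by positivity) hl
  have hl0 : 0 < l := by exact_mod_cast hl0'
  have hWle := W_le a b η γ p₁ c n l ha hb0 hγ hγ1.le hp₁ hp₁1 hc hn3 hl
  rw [← hCd] at hWle
  have hexp : Real.exp (-(l * γ * (ε * η / 2))) ≤ 1 / ((n:ℝ) * n) := by
    have : -(l * γ * (ε * η / 2)) ≤ -(2 * Real.log n) := by
      have h1 : c * Real.log n * (γ * (ε * η / 2)) ≤ l * (γ * (ε * η / 2)) := by gcongr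
      have h2 : c * Real.log n * (γ * (ε * η / 2)) = 2 * Real.log n := by
        rw [hcd]; field_simp; ring
      linarith
    refine (Real.exp_le_exp.mpr this).trans (le_of_eq ?_)
    rw [Real.exp_neg, two_mul, Real.exp_add, Real.exp_log hn0, one_div]
  have hW : (∑ i ∈ Finset.range n, hpot a b η l (zlev γ p₁ n i) 0) *
      Real.exp (-(l * γ * (ε * η / 2))) ≤ 1 := by
    calc _ ≤ (C * n) * (1 / ((n:ℝ) * n)) := by gcongr
      _ = C / n := by field_simp
      _ ≤ 1 := by rw [div_le_one hn0]; exact hCn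
  have hsel : ∀ P : Popn n l, ∀ j ≤ n - r, (1 + ε) * min ((cntGe P j : ℝ) / l) γ
      ≤ p₀ * ∑ i with j ≤ ones (P i), (sel P i).toReal := by
    intro P j hj
    rw [hεd, hγd]
    rcases hs with ⟨k, hk, hs⟩ | ⟨μ, hμ0, hμ, hs⟩
    · exact tourn_lower hl0 p₀ δ hp₀ hδ0 hδ1 sel hk hs P j hj
    · exact muc_lower hl0 p₀ δ hp₀ hδ0 hδ1 sel hμ0 hμ hs P j hj
  have hr0 : 0 < r := by omega
  have hg0 : ∀ P : Popn n l, 0 ≤ gpot a b η γ p₁ r P :=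
    gpot_nonneg a b η γ p₁ r ha hb0 hγ hγ1.le hp₁ hp₁1 hr0 hrn
  refine (drift_ennreal P₀ (eaStep sel mutOp) _ (fun P => ENNReal.ofReal (gpot a b η γ p₁ r P))
    ?_).trans ?_
  · intro P hP
    have hP' : (cntGe P (n - r) : ℝ) < γ * l := not_le.mp hP
    have h := drift_step a b ε η γ p₀ p₁ r ha hε hε1 hη hγ hγ1.le hp₀ hp₀1 hp₁ hp₁1 hr0 hrn hl0
      hb ha1 ha2 hW sel mutOp hu hm hm1 hsel P hP'
    refine le_trans (le_of_eq ?_) (ENNReal.ofReal_le_ofReal h)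
    have hnn : ∀ Q, 0 ≤ (eaStep sel mutOp P Q).toReal * gpot a b η γ p₁ r Q := fun Q =>
      mul_nonneg ENNReal.toReal_nonneg (hg0 Q)
    rw [ENNReal.ofReal_add (Finset.sum_nonneg fun Q _ => hnn Q) one_pos.le,
      ENNReal.ofReal_sum_of_nonneg fun Q _ => hnn Q, ENNReal.ofReal_one]
    congr 1
    apply Finset.sum_congr rfl
    intro Q _
    rw [ENNReal.ofReal_mul ENNReal.toReal_nonneg, ENNReal.ofReal_toReal (PMF.apply_ne_top _ _)]
  · apply ENNReal.ofReal_le_ofReal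
    refine le_trans ?_ hWle
    rw [Finset.range_eq_Ico]
    exact gpot_le_tail a b η γ p₁ r ha hb0 hη0 hγ hγ1.le hp₁ hp₁1 hr0 hrn P₀ 0 (Nat.zero_le _)
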